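/- Let V = ℚ^{<ω} be the ℚ-vector space of finitely supported functions ℕ → ℚ, and let AGL(V) be the group of permutations of V of the form x ↦ T x + b with T : V → V an invertible ℚ-linear map and b ∈ V. If G is a subgroup of the group of all permutations of V that properly contains AGL(V), then G is highly transitive: for every k ≥ 1 and any two k-tuples of pairwise distinct points of V there is an element of G mapping the first tuple to the second. -/

import Mathlib

/-- `σ` is an element of `AGL(V)` for `V = ℚ^{<ω}` (finitely supported functions `ℕ → ℚ`):
a permutation of `V` of the form `x ↦ T x + b` with `T` an invertible `ℚ`-linear map
and `b ∈ V`. -/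
def IsAGLomega (σ : Equiv.Perm (ℕ →₀ ℚ)) : Prop :=
  ∃ T : (ℕ →₀ ℚ) ≃ₗ[ℚ] (ℕ →₀ ℚ), ∃ b : ℕ →₀ ℚ, ∀ x, σ x = T x + b

section Affine

variable {V : Type*} [AddCommGroup V] [Module ℚ V]

/-- The embedding of `V` as the affine hyperplane at height `1` of `V × ℚ`. -/
def homog (x : V) : V × ℚ := (x, 1)

/-- A group of permutations contains every affine permutation. -/
def ContainsAffine (G : Subgroup (Equiv.Perm V)) : Prop :=
  ∀ σ : Equiv.Perm V, (∃ T : V ≃ₗ[ℚ] V, ∃ b : V, ∀ x, σ x = T x + b) → σ ∈ G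

/-- Some element of `G` maps `s` to an affinely independent set. -/
def Spreadable (G : Subgroup (Equiv.Perm V)) (s : Set V) : Prop :=
  ∃ g ∈ G, LinearIndepOn ℚ homog (g '' s)

lemma homog_add_smul_sub (x a b : V) (t : ℚ) :
    homog (x + t • (a - b)) = homog x + t • (homog a - homog b) := by
  simp [homog]

lemma spreadable_image_iff {G : Subgroup (Equiv.Perm V)} {h : Equiv.Perm V} (hh : h ∈ G)
    (s : Set V) : Spreadable G (h '' s) ↔ Spreadable G s := by
  constructor
  · rintro ⟨g, hg, hi⟩
    exact ⟨g * h, G.mul_mem hg hh, by simpa [Set.image_image] using hi⟩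
  · rintro ⟨g, hg, hi⟩
    exact ⟨g * h⁻¹, G.mul_mem hg (G.inv_mem hh), by simpa [Set.image_image] using hi⟩

lemma spreadable_of_linearIndepOn {G : Subgroup (Equiv.Perm V)} {s : Set V}
    (hs : LinearIndepOn ℚ homog s) : Spreadable G s :=
  ⟨1, G.one_mem, by simpa using hs⟩

/-- A linear functional on `V × ℚ` with prescribed values on an independent set. -/
lemma LinearIndepOn.exists_functional {s : Set V} (hs : LinearIndepOn ℚ homog s) (c : V → ℚ) :
    ∃ f : V × ℚ →ₗ[ℚ] ℚ, ∀ x ∈ s, f (homog x) = c x := by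
  obtain ⟨f, hf⟩ := LinearMap.exists_extend
    ((Module.Basis.span hs.linearIndependent_restrict).constr ℚ fun x : s => c x)
  refine ⟨f, fun x hx => ?_⟩
  have h1 := congrArg (fun l => l (Module.Basis.span hs.linearIndependent_restrict ⟨x, hx⟩)) hf
  simp only [Module.Basis.constr_basis] at h1
  rw [← h1]
  simp [Module.Basis.span_apply]

lemma exists_functional_eq_one {s : Set (V × ℚ)} {x : V × ℚ} (hx : x ∉ Submodule.span ℚ s) :
    ∃ f : V × ℚ →ₗ[ℚ] ℚ, f x = 1 ∧ ∀ z ∈ Submodule.span ℚ s, f z = 0 := by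
  obtain ⟨f, hf, hle⟩ := Submodule.exists_le_ker_of_notMem hx
  exact ⟨(f x)⁻¹ • f, by simp [hf], fun z hz => by simp [LinearMap.mem_ker.1 (hle hz)]⟩

lemma ContainsAffine.exists_shear {G : Subgroup (Equiv.Perm V)} (hG : ContainsAffine G)
    (f : V × ℚ →ₗ[ℚ] ℚ) (u : V) (hu : 1 + f (u, 0) ≠ 0) :
    ∃ σ ∈ G, ∀ x, σ x = x + f (homog x) • u := by
  let l : V →ₗ[ℚ] ℚ := f ∘ₗ LinearMap.inl ℚ V ℚ
  have hl : 1 + l u ≠ 0 := hu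
  let T : V ≃ₗ[ℚ] V := LinearEquiv.ofLinearMap
    (LinearMap.id + l.smulRight u) (LinearMap.id - ((1 + l u)⁻¹ • l).smulRight u)
    (by
      ext v
      simp only [LinearMap.comp_apply, LinearMap.add_apply, LinearMap.sub_apply,
        LinearMap.id_apply, LinearMap.smulRight_apply, LinearMap.smul_apply, map_sub, map_smul,
        smul_eq_mul]
      match_scalars <;> field_simp
      ring)
    (by
      ext v
      simp only [LinearMap.comp_apply, LinearMap.add_apply, LinearMap.sub_apply,
        LinearMap.id_apply, LinearMap.smulRight_apply, LinearMap.smul_apply, map_add, map_smul,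
        smul_eq_mul]
      match_scalars <;> field_simp
      ring)
  refine ⟨T.toEquiv.trans (Equiv.addRight (f (0, 1) • u)), hG _ ⟨T, f (0, 1) • u, fun x => rfl⟩,
    fun x => ?_⟩
  have h1 : f (homog x) = l x + f (0, 1) := by
    simp [l, homog, ← map_add]
  change x + l x • u + f (0, 1) • u = _
  rw [h1]
  module

lemma ContainsAffine.exists_move {G : Subgroup (Equiv.Perm V)} (hG : ContainsAffine G)
    {s : Set V} {x y : V} (hx : homog x ∉ Submodule.span ℚ (homog '' s))
    (hy : homog y ∉ Submodule.span ℚ (homog '' s)) :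
    ∃ σ ∈ G, (∀ z, homog z ∈ Submodule.span ℚ (homog '' s) → σ z = z) ∧ σ x = y := by
  obtain ⟨f, hfx, hfy, hf⟩ : ∃ f : V × ℚ →ₗ[ℚ] ℚ, f (homog x) = 1 ∧ f (homog y) ≠ 0 ∧
      ∀ z ∈ Submodule.span ℚ (homog '' s), f z = 0 := by
    obtain ⟨f, h1, h2⟩ := exists_functional_eq_one hx
    obtain ⟨f', h1', h2'⟩ := exists_functional_eq_one hy
    by_cases hfy : f (homog y) = 0
    · by_cases hfx : f' (homog x) = 0
      · exact ⟨f + f', by simp [h1, hfx], by simp [h1', hfy],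
          fun z hz => by simp [h2 z hz, h2' z hz]⟩
      · exact ⟨(f' (homog x))⁻¹ • f', by simp [hfx], by simp [h1', hfx],
          fun z hz => by simp [h2' z hz]⟩
    · exact ⟨f, h1, hfy, h2⟩
  have hxy : ((y - x, 0) : V × ℚ) = homog y - homog x := by simp [homog]
  obtain ⟨σ, hσ, h⟩ := hG.exists_shear f (y - x) (by rw [hxy]; simpa [hfx] using hfy)
  exact ⟨σ, hσ, fun z hz => by simp [h, hf _ hz], by simp [h, hfx]⟩

/-- An affine permutation swapping two points of an independent set and fixing the others; it
moves every point along the direction joining the two. -/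
lemma ContainsAffine.exists_swap {G : Subgroup (Equiv.Perm V)} (hG : ContainsAffine G)
    {s : Set V} {i j : V} (hi : i ∈ s) (hj : j ∈ s)
    {f : V × ℚ →ₗ[ℚ] ℚ} (hfi : f (homog i) = 1) (hfj : f (homog j) = -1)
    (hf : ∀ x ∈ s, x ≠ i → x ≠ j → f (homog x) = 0) :
    ∃ σ ∈ G, σ '' s = s ∧ ∀ x, σ x = x + f (homog x) • (j - i) := by
  have hji : ((j - i, 0) : V × ℚ) = homog j - homog i := by simp [homog]
  obtain ⟨σ, hσ, h⟩ := hG.exists_shear f (j - i) (by rw [hji]; norm_num [hfi, hfj])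
  have hσi : σ i = j := by simp [h, hfi]
  have hσj : σ j = i := by simp [h, hfj]
  have hσx : ∀ x ∈ s, x ≠ i → x ≠ j → σ x = x := fun x hx h1 h2 => by simp [h, hf x hx h1 h2]
  refine ⟨σ, hσ, Set.Subset.antisymm ?_ ?_, h⟩
  · rintro _ ⟨x, hx, rfl⟩
    by_cases h1 : x = i
    · rwa [h1, hσi]
    by_cases h2 : x = j
    · rwa [h2, hσj]
    rwa [hσx x hx h1 h2]
  · intro x hx
    by_cases h1 : x = i
    · exact ⟨j, hj, by rw [hσj, h1]⟩
    by_cases h2 : x = j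
    · exact ⟨i, hi, by rw [hσi, h2]⟩
    exact ⟨x, hx, hσx x hx h1 h2⟩

lemma linearIndependent_homog_affine {ι : Type*} {p : ι → V}
    (hp : LinearIndependent ℚ fun i => homog (p i)) (T : V ≃ₗ[ℚ] V) (b : V) :
    LinearIndependent ℚ fun i => homog (T (p i) + b) := by
  let F : V × ℚ →ₗ[ℚ] V × ℚ :=
    (T.toLinearMap ∘ₗ LinearMap.fst ℚ V ℚ + (LinearMap.snd ℚ V ℚ).smulRight b).prod
      (LinearMap.snd ℚ V ℚ)
  have hF : F.ker = ⊥ := by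
    rw [LinearMap.ker_eq_bot']
    rintro ⟨v, t⟩ h
    have ht : t = 0 := congrArg Prod.snd h
    subst ht
    have hv : T v + (0 : ℚ) • b = 0 := congrArg Prod.fst h
    simpa using hv
  have := hp.map' F hF
  simpa [Function.comp_def, F, homog] using this

/-- The affine permutations act transitively on affinely independent tuples. -/
lemma exists_affine_map_eq (k : ℕ) (p q : Fin k → V)
    (hp : LinearIndependent ℚ fun i => homog (p i))
    (hq : LinearIndependent ℚ fun i => homog (q i)) :
    ∃ T : V ≃ₗ[ℚ] V, ∃ b : V, ∀ i, T (p i) + b = q i := by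
  induction k with
  | zero => exact ⟨LinearEquiv.refl ℚ V, 0, fun i => i.elim0⟩
  | succ k ih =>
    let H : Subgroup (Equiv.Perm V) :=
      { carrier := {σ | ∃ T : V ≃ₗ[ℚ] V, ∃ b : V, ∀ x, σ x = T x + b}
        one_mem' := ⟨LinearEquiv.refl ℚ V, 0, by simp⟩
        mul_mem' := by
          rintro σ τ ⟨S, a, hS⟩ ⟨T, b, hT⟩
          exact ⟨T.trans S, S b + a, fun x => by simp [hS, hT, add_assoc]⟩
        inv_mem' := by
          rintro σ ⟨T, b, hT⟩
          refine ⟨T.symm, -T.symm b, fun x => ?_⟩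
          rw [Equiv.Perm.inv_eq_iff_eq, hT]
          simp }
    have hH : ContainsAffine H := fun σ hσ => hσ
    have hp' := linearIndependent_finSucc'.1 hp
    obtain ⟨T, b, hT⟩ := ih (fun i => p i.castSucc) (fun i => q i.castSucc) hp'.1
      (linearIndependent_finSucc'.1 hq).1
    have hTp := linearIndependent_finSucc'.1 (linearIndependent_homog_affine hp T b)
    have hr : Set.range (Fin.init fun i => homog (q i)) =
        homog '' Set.range fun i : Fin k => q i.castSucc := by
      rw [← Set.range_comp]
      rfl
    have hr' : Set.range (Fin.init fun i => homog (T (p i) + b)) =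
        homog '' Set.range fun i : Fin k => q i.castSucc := by
      rw [← hr]
      congr 1
      funext i
      exact congrArg homog (hT i)
    obtain ⟨σ, ⟨S, a, hS⟩, hfix, hσ⟩ := hH.exists_move (hr' ▸ hTp.2)
      (hr ▸ (linearIndependent_finSucc'.1 hq).2)
    refine ⟨T.trans S, S b + a, fun i => ?_⟩
    have h1 : ∀ x, (T.trans S) x + (S b + a) = σ (T x + b) := fun x => by simp [hS, add_assoc]
    rw [h1]
    refine Fin.lastCases hσ (fun i => ?_) i
    rw [hT]
    exact hfix _ (Submodule.subset_span ⟨_, ⟨i, rfl⟩, rfl⟩)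

/-- A non-spreadable set obtained by adding to a spreadable set a point outside its span
yields a nontrivial element of `G` fixing everything outside the span of a finite set. -/
lemma exists_small_support {G : Subgroup (Equiv.Perm V)} (hG : ContainsAffine G)
    {A : Set V} (hA : A.Finite) (hM : Spreadable G A) {b : V}
    (hb : homog b ∉ Submodule.span ℚ (homog '' A)) (hbA : ¬ Spreadable G (insert b A))
    (hinf : ∀ s : Set V, s.Finite → ∃ x y, x ≠ y ∧ homog x ∉ Submodule.span ℚ (homog '' s) ∧
      homog y ∉ Submodule.span ℚ (homog '' s)) :
    ∃ g ∈ G, (∃ x, g x ≠ x) ∧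
      ∀ x, homog x ∉ Submodule.span ℚ (homog '' A) → g x = x := by
  obtain ⟨g, hg, hi⟩ := hM
  have hout : ∀ c, homog c ∉ Submodule.span ℚ (homog '' A) →
      homog (g c) ∈ Submodule.span ℚ (homog '' (g '' A)) := by
    intro c hc
    by_contra hcon
    obtain ⟨σ, hσ, hfix, hσb⟩ := hG.exists_move hb hc
    have himg : σ '' insert b A = insert c A := by
      rw [Set.image_insert_eq, hσb]
      congr 1
      refine (Set.image_congr fun z hz => ?_).trans (Set.image_id A)
      exact hfix z (Submodule.subset_span ⟨z, hz, rfl⟩)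
    rw [← spreadable_image_iff hσ, himg] at hbA
    exact hbA ⟨g, hg, by
      rw [Set.image_insert_eq]
      exact ((hi.notMem_span_iff).1 hcon).1⟩
  obtain ⟨x, y, hxy, hx, hy⟩ := hinf _ (hA.image g)
  obtain ⟨τ, hτ, hfix, hτx⟩ := hG.exists_move hx hy
  refine ⟨g⁻¹ * τ * g, G.mul_mem (G.mul_mem (G.inv_mem hg) hτ) hg, ⟨g⁻¹ x, fun h => hxy ?_⟩,
    fun c hc => ?_⟩
  · have h2 := congrArg g h
    simpa [hτx] using h2.symm
  · simp [hfix _ (hout c hc)]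

end Affine

lemma collinear_triple_iff {V : Type*} [AddCommGroup V] [Module ℚ V] {a b : V} (hab : a ≠ b)
    (c : V) : Collinear ℚ {a, b, c} ↔ ∃ t : ℚ, c = a + t • (b - a) := by
  constructor
  · intro h
    obtain ⟨v, hv⟩ := (collinear_iff_of_mem (p₀ := a) (by simp)).1 h
    obtain ⟨r, hr⟩ := hv b (by simp)
    obtain ⟨s, hs⟩ := hv c (by simp)
    simp only [vadd_eq_add] at hr hs
    have hr0 : r ≠ 0 := by
      rintro rfl
      simp at hr
      exact hab hr.symm
    refine ⟨s / r, ?_⟩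
    rw [hs, hr]
    match_scalars <;> field_simp
    ring
  · rintro ⟨t, rfl⟩
    refine (collinear_iff_of_mem (p₀ := a) (by simp)).2 ⟨b - a, ?_⟩
    simp only [Set.mem_insert_iff, Set.mem_singleton_iff, forall_eq_or_imp, forall_eq,
      vadd_eq_add]
    exact ⟨⟨0, by simp⟩, ⟨1, by simp⟩, ⟨t, by abel⟩⟩

section Fundamental

variable {V : Type*} [AddCommGroup V] [Module ℚ V]

lemma exists_map_add_eq {g : Equiv.Perm V} (h0 : g 0 = 0)
    (hcol : ∀ a b c : V, Collinear ℚ {g a, g b, g c} ↔ Collinear ℚ {a, b, c})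
    {x y : V} (hxy : LinearIndependent ℚ ![x, y]) : ∃ v : ℚ, g (x + y) = g x + v • g y := by
  rw [LinearIndependent.pair_iff] at hxy
  have hx : x ≠ 0 := by
    rintro rfl
    simpa using hxy 1 0
  have hy : y ≠ 0 := by
    rintro rfl
    simpa using hxy 0 1
  have hne : x ≠ y := by
    rintro rfl
    simpa using hxy 1 (-1)
  have hm : x + (1 / 2 : ℚ) • (y - x) ≠ 0 := fun h => by
    have := hxy (1 / 2) (1 / 2) (by rw [← h]; module)
    norm_num at this
  have gne : ∀ {z : V}, z ≠ 0 → (0 : V) ≠ g z := fun hz h => hz (g.injective (h.symm.trans h0.symm))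
  obtain ⟨α, hα⟩ := (collinear_triple_iff (g.injective.ne hne) _).1
    ((hcol _ _ _).2 ((collinear_triple_iff hne _).2 ⟨1 / 2, rfl⟩))
  obtain ⟨β, hβ⟩ := (collinear_triple_iff (gne hm) _).1 (h0 ▸
    (hcol _ _ _).2 ((collinear_triple_iff (Ne.symm hm) (x + y)).2 ⟨2, by module⟩))
  rw [hα] at hβ
  obtain ⟨u, hu⟩ : ∃ u, u = β * (1 - α) := ⟨_, rfl⟩
  obtain ⟨v, hv⟩ : ∃ v, v = β * α := ⟨_, rfl⟩
  have hp : g (x + y) = u • g x + v • g y := by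
    rw [hβ, hu, hv]
    module
  by_cases hu1 : u = 1
  · exact ⟨v, by rw [hp, hu1, one_smul]⟩
  exfalso
  have hu1' : 1 - u ≠ 0 := sub_ne_zero.2 (Ne.symm hu1)
  have hxp : x ≠ x + y := by simpa using hy
  obtain ⟨w, hw⟩ := g.surjective (((1 - u)⁻¹ * v) • g y)
  obtain ⟨s, hs⟩ := (collinear_triple_iff hxp w).1 ((hcol _ _ _).1
    ((collinear_triple_iff (g.injective.ne hxp) _).2 ⟨(1 - u)⁻¹, by
      rw [hw, hp]
      match_scalars <;> field_simp
      ring⟩))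
  obtain ⟨r, hr⟩ := (collinear_triple_iff (Ne.symm hy) w).1 ((hcol _ _ _).1
    (by
      rw [h0]
      exact (collinear_triple_iff (gne hy) _).2 ⟨(1 - u)⁻¹ * v, by rw [hw]; module⟩))
  have := hxy 1 (s - r) (by
    have h3 := hs.symm.trans hr
    rw [← sub_eq_zero] at h3
    rw [← h3]
    module)
  simp at this

/-- Additivity on independent pairs of a collineation fixing the origin. -/
lemma map_add_of_linearIndependent {g : Equiv.Perm V} (h0 : g 0 = 0)
    (hcol : ∀ a b c : V, Collinear ℚ {g a, g b, g c} ↔ Collinear ℚ {a, b, c})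
    {x y : V} (hxy : LinearIndependent ℚ ![x, y]) : g (x + y) = g x + g y := by
  obtain ⟨v, hv⟩ := exists_map_add_eq h0 hcol hxy
  obtain ⟨u, hu⟩ := exists_map_add_eq h0 hcol (LinearIndependent.pair_symm_iff.1 hxy)
  rw [add_comm, hv] at hu
  by_cases hv1 : v = 1
  · rw [hv, hv1, one_smul]
  exfalso
  have hv1' : 1 - v ≠ 0 := sub_ne_zero.2 (Ne.symm hv1)
  have hx : x ≠ 0 := by
    rintro rfl
    rw [LinearIndependent.pair_iff] at hxy
    simpa using hxy 1 0
  have hgx : (0 : V) ≠ g x := fun h => hx (g.injective (h.symm.trans h0.symm))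
  have hy : g y = 0 + ((1 - u) * (1 - v)⁻¹) • (g x - 0) := by
    have h1 : (1 - v) • g y = (1 - u) • g x := by
      rw [← sub_eq_zero] at hu ⊢
      rw [← neg_eq_zero, ← hu]
      module
    have h2 : g y = (1 - v)⁻¹ • (1 - v) • g y := by rw [smul_smul, inv_mul_cancel₀ hv1', one_smul]
    rw [h2, h1]
    module
  obtain ⟨t, ht⟩ := (collinear_triple_iff (Ne.symm hx) y).1 ((hcol _ _ _).1 (by
    rw [h0]
    exact (collinear_triple_iff hgx _).2 ⟨_, hy⟩))
  rw [LinearIndependent.pair_iff] at hxy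
  have := hxy t (-1) (by rw [ht]; module)
  simp at this

/-- The fundamental theorem of affine geometry over `ℚ`, in dimension at least two. -/
lemma exists_affine_of_collinear_iff (hdim : ∀ x : V, ∃ z, z ∉ Submodule.span ℚ {x})
    (g : Equiv.Perm V)
    (hcol : ∀ a b c : V, Collinear ℚ {g a, g b, g c} ↔ Collinear ℚ {a, b, c}) :
    ∃ T : V ≃ₗ[ℚ] V, ∃ b : V, ∀ x, g x = T x + b := by
  let h : Equiv.Perm V := g.trans (Equiv.subRight (g 0))
  have hh : ∀ x, h x = g x - g 0 := fun x => rfl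
  have h0 : h 0 = 0 := by simp [hh]
  have hcol' : ∀ a b c : V, Collinear ℚ {h a, h b, h c} ↔ Collinear ℚ {a, b, c} := by
    intro a b c
    rw [← hcol a b c]
    by_cases hab : a = b
    · simp [hab, collinear_pair]
    rw [collinear_triple_iff (h.injective.ne hab), collinear_triple_iff (g.injective.ne hab)]
    refine exists_congr fun t => ?_
    rw [hh, hh, hh, sub_eq_iff_eq_add]
    refine Eq.congr_right ?_
    module
  have hind : ∀ {x z : V}, x ≠ 0 → z ∉ Submodule.span ℚ {x} → LinearIndependent ℚ ![x, z] := by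
    intro x z hx hz
    rw [LinearIndependent.pair_iff' hx]
    exact fun a ha => hz (Submodule.mem_span_singleton.2 ⟨a, ha⟩)
  have hadd : ∀ x y, h (x + y) = h x + h y := by
    intro x y
    by_cases hx : x = 0
    · simp [hx, h0]
    by_cases hy : y ∈ Submodule.span ℚ {x}
    · obtain ⟨z, hz⟩ := hdim x
      obtain ⟨c, rfl⟩ := Submodule.mem_span_singleton.1 hy
      have hadd' : ∀ t : ℚ, h (t • x + z) = h (t • x) + h z := by
        intro t
        by_cases ht : t = 0
        · simp [ht, h0]
        refine map_add_of_linearIndependent h0 hcol' (hind (smul_ne_zero ht hx) ?_)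
        rwa [Submodule.span_singleton_smul_eq (Ne.isUnit ht)]
      have h1 : h (x + (c • x + z)) = h x + h (c • x + z) := by
        refine map_add_of_linearIndependent h0 hcol' (hind hx fun hmem => hz ?_)
        exact (Submodule.add_mem_iff_right _ hy).1 hmem
      have h2 := hadd' (1 + c)
      rw [hadd' c, ← add_assoc, ← add_assoc] at h1
      rw [add_smul, one_smul, h1] at h2
      exact (add_right_cancel h2).symm
    · exact map_add_of_linearIndependent h0 hcol' (hind hx hy)
  refine ⟨LinearEquiv.ofBijective (AddMonoidHom.mk' h hadd).toRatLinearMap h.bijective, g 0,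
    fun x => ?_⟩
  change g x = h x + g 0
  rw [hh, sub_add_cancel]

end Fundamental

section Low

variable {V : Type*} [AddCommGroup V] [Module ℚ V]

lemma linearIndepOn_homog_pair {a b : V} (hab : a ≠ b) : LinearIndepOn ℚ homog {a, b} := by
  rw [LinearIndepOn.pair_iff _ hab]
  intro c d h
  have h2 : c + d = 0 := by simpa [homog] using congrArg Prod.snd h
  have h1 : c • a + d • b = 0 := by simpa [homog] using congrArg Prod.fst h
  have h3 : c • (a - b) = 0 := by
    rw [← h1, eq_neg_of_add_eq_zero_right h2]
    module
  have hc : c = 0 := (smul_eq_zero.1 h3).resolve_right (sub_ne_zero.2 hab)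
  exact ⟨hc, by linarith⟩

lemma linearIndepOn_homog_of_not_collinear {a b c : V} (h : ¬ Collinear ℚ {a, b, c}) :
    LinearIndepOn ℚ homog {a, b, c} := by
  have hab : a ≠ b := by
    rintro rfl
    simp [collinear_pair] at h
  have hset : ({a, b, c} : Set V) = insert c {a, b} := by grind
  rw [hset]
  refine ((linearIndepOn_homog_pair hab).notMem_span_iff.1 fun hc => h ?_).1
  rw [Set.image_pair, Submodule.mem_span_pair] at hc
  obtain ⟨p, q, hpq⟩ := hc
  have h2 : p + q = 1 := by simpa [homog] using congrArg Prod.snd hpq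
  have h1 : p • a + q • b = c := by simpa [homog] using congrArg Prod.fst hpq
  refine (collinear_triple_iff hab c).2 ⟨q, ?_⟩
  rw [← h1, eq_sub_of_add_eq h2]
  module

lemma eq_univ_of_div_mem {S : Set ℚ} (hsub : ∀ t ∈ S, 1 - t ∈ S)
    (hdiv : ∀ s ∈ S, ∀ t ∈ S, t ≠ 0 → s / t ∈ S) {s : ℚ} (hs : s ∈ S) (h0 : s ≠ 0)
    (h1 : s ≠ 1) : S = Set.univ := by
  have one_mem : (1 : ℚ) ∈ S := by simpa [h0] using hdiv s hs s hs h0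
  have zero_mem : (0 : ℚ) ∈ S := by simpa using hsub 1 one_mem
  have h1s : 1 - s ≠ 0 := sub_ne_zero.2 (Ne.symm h1)
  have neg_one_mem : (-1 : ℚ) ∈ S := by
    have h2 := hsub _ (hdiv 1 one_mem s hs h0)
    have h3 := hdiv _ h2 _ (hdiv 1 one_mem s hs h0) (by simpa using h0)
    have h4 := hdiv _ h3 _ (hsub s hs) h1s
    convert h4 using 1
    field_simp
    ring
  have neg_mem : ∀ t ∈ S, -t ∈ S := fun t ht => by
    simpa [div_neg] using hdiv t ht (-1) neg_one_mem (by norm_num)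
  have nat_mem : ∀ n : ℕ, (n : ℚ) ∈ S := by
    intro n
    induction n with
    | zero => simpa using zero_mem
    | succ n ih => simpa [add_comm] using hsub _ (neg_mem _ ih)
  refine Set.eq_univ_of_forall fun q => ?_
  rw [← Rat.num_div_den q]
  refine hdiv _ ?_ _ (nat_mem _) (by simp)
  obtain ⟨n, hn | hn⟩ := Int.eq_nat_or_neg q.num
  · rw [hn]
    exact nat_mem n
  · rw [hn]
    simpa using neg_mem _ (nat_mem n)

/-- If some triple is not spreadable, then `G` preserves collinearity and hence is affine. -/
lemma exists_affine_of_not_spreadable_triple {G : Subgroup (Equiv.Perm V)}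
    (hG : ContainsAffine G) (hdim : ∀ x : V, ∃ z, z ∉ Submodule.span ℚ {x}) {D : Set V}
    (hD : D.encard = 3) (hM : ¬ Spreadable G D) {g : Equiv.Perm V} (hg : g ∈ G) :
    ∃ T : V ≃ₗ[ℚ] V, ∃ b : V, ∀ x, g x = T x + b := by
  let L : V → V → V → Prop := fun a b c => ∀ g ∈ G, Collinear ℚ {g a, g b, g c}
  have transfer : ∀ {a b a' b' : V} {t : ℚ}, a ≠ b → a' ≠ b' → L a b (a + t • (b - a)) →
      L a' b' (a' + t • (b' - a')) := by
    intro a b a' b' t hab hab' h g hg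
    have hind : ∀ {a b : V}, a ≠ b → LinearIndependent ℚ fun i => homog (![a, b] i) := by
      intro a b hab
      have h1 := linearIndepOn_homog_pair hab
      have hinj : Function.Injective ![a, b] := by
        intro i j hij
        fin_cases i <;> fin_cases j <;> simp_all
      rw [← Matrix.range_cons_cons_empty a b ![], linearIndepOn_range_iff hinj] at h1
      exact h1
    obtain ⟨T, v, hT⟩ := exists_affine_map_eq 2 ![a, b] ![a', b'] (hind hab) (hind hab')
    have ha : T a + v = a' := hT 0
    have hb : T b + v = b' := hT 1
    have hσ : T.toEquiv.trans (Equiv.addRight v) ∈ G := hG _ ⟨T, v, fun x => rfl⟩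
    have := h _ (G.mul_mem hg hσ)
    simp only [Equiv.Perm.mul_apply, Equiv.trans_apply, LinearEquiv.coe_toEquiv,
      Equiv.coe_addRight] at this
    rw [ha, hb] at this
    have heq : T (a + t • (b - a)) + v = a' + t • (b' - a') := by
      rw [← ha, ← hb, map_add, map_smul, map_sub]
      module
    rwa [heq] at this
  obtain ⟨a, b, c, hab, hac, hbc, rfl⟩ := Set.encard_eq_three.1 hD
  have hL : L a b c := by
    intro g hg
    by_contra hcon
    refine hM ⟨g, hg, ?_⟩
    rw [Set.image_insert_eq, Set.image_pair]
    exact linearIndepOn_homog_of_not_collinear hcon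
  obtain ⟨s, rfl⟩ := (collinear_triple_iff hab c).1 (hL 1 G.one_mem)
  have hs0 : s ≠ 0 := by
    rintro rfl
    simp at hac
  have hs1 : s ≠ 1 := by
    rintro rfl
    simp at hbc
  have huniv : {t : ℚ | L a b (a + t • (b - a))} = Set.univ := by
    refine eq_univ_of_div_mem (fun t ht => ?_) (fun r hr t ht ht0 => ?_) hL hs0 hs1
    · intro g hg
      have := transfer hab (Ne.symm hab) ht g hg
      rw [Set.insert_comm] at this
      have heq : b + t • (a - b) = a + (1 - t) • (b - a) := by module
      rwa [heq] at this
    · have hne : a ≠ a + t • (b - a) := by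
        simp [ht0, sub_eq_zero, Ne.symm hab]
      refine transfer hne hab (t := r / t) fun g hg => ?_
      have heq : a + (r / t) • (a + t • (b - a) - a) = a + r • (b - a) := by
        rw [add_sub_cancel_left, smul_smul, div_mul_cancel₀ _ ht0]
      rw [heq]
      have hgab := g.injective.ne hab
      obtain ⟨t', ht'⟩ := (collinear_triple_iff hgab _).1 (ht g hg)
      obtain ⟨r', hr'⟩ := (collinear_triple_iff hgab _).1 (hr g hg)
      refine (collinear_iff_of_mem (p₀ := g a) (by simp)).2 ⟨g b - g a, ?_⟩
      simp only [Set.mem_insert_iff, Set.mem_singleton_iff, forall_eq_or_imp, forall_eq,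
        vadd_eq_add]
      exact ⟨⟨0, by simp⟩, ⟨t', by rw [ht', add_comm]⟩, ⟨r', by rw [hr', add_comm]⟩⟩
  have hcol : ∀ g ∈ G, ∀ x y z : V, Collinear ℚ {x, y, z} → Collinear ℚ {g x, g y, g z} := by
    intro g hg x y z h
    by_cases hxy : x = y
    · simp [hxy, collinear_pair]
    obtain ⟨t, rfl⟩ := (collinear_triple_iff hxy z).1 h
    have ht : t ∈ {t : ℚ | L a b (a + t • (b - a))} := huniv ▸ Set.mem_univ t
    exact transfer hab hxy ht g hg
  exact exists_affine_of_collinear_iff hdim g fun x y z =>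
    ⟨fun h => by simpa using hcol _ (G.inv_mem hg) _ _ _ h, hcol g hg x y z⟩

end Low

section High

variable {V : Type*} [AddCommGroup V] [Module ℚ V] {G : Subgroup (Equiv.Perm V)} {k : ℕ}

lemma exists_mem_notMem_of_encard_lt {α : Type*} {s t : Set α} (h : s.encard < t.encard) :
    ∃ x ∈ t, x ∉ s :=
  Set.not_subset.1 fun hts => h.not_ge (Set.encard_le_encard hts)

lemma eq_insert_four {α : Type*} {D : Set α} {l m i j : α} (hl : l ∈ D) (hm : m ∈ D)
    (hi : i ∈ D) (hj : j ∈ D) (hml : m ≠ l) (hli : l ≠ i) (hlj : l ≠ j) (hmi : m ≠ i)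
    (hmj : m ≠ j) :
    D = insert l (insert m (insert i (insert j (D \ {l, m, i, j})))) ∧
      D \ {l} = insert m (insert i (insert j (D \ {l, m, i, j}))) ∧
      D \ {m} = insert l (insert i (insert j (D \ {l, m, i, j}))) := by
  refine ⟨?_, ?_, ?_⟩ <;> ext x <;>
    simp only [Set.mem_insert_iff, Set.mem_sdiff, Set.mem_singleton_iff] <;> grind

lemma not_spreadable_image {h : Equiv.Perm V} (hh : h ∈ G) {s : Set V} (hs : ¬ Spreadable G s) :
    ¬ Spreadable G (h '' s) :=
  fun H => hs ((spreadable_image_iff hh s).1 H)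

/-- In a minimal non-spreadable set with one independent maximal proper subset, all maximal proper
subsets are independent. -/
lemma linearIndepOn_diff_singleton
    (hspan : ∀ (A : Set V) (b : V), A.encard = k → ¬ Spreadable G (insert b A) →
      homog b ∈ Submodule.span ℚ (homog '' A))
    {D : Set V} (hD : D.encard = k + 1) (hM : ¬ Spreadable G D) {a l : V} (ha : a ∈ D)
    (hl : l ∈ D) (hI : LinearIndepOn ℚ homog (D \ {a})) : LinearIndepOn ℚ homog (D \ {l}) := by
  by_cases hal : a = l
  · rwa [← hal]
  have h1 : D \ {l} = insert a (D \ {a, l}) := by grind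
  have h2 : D \ {a} = insert l (D \ {a, l}) := by grind
  have hcard : (D \ {l}).encard = k := by
    have := Set.encard_sdiff_singleton_add_one hl
    rw [hD] at this
    exact ENat.add_left_injective_of_ne_top ENat.one_ne_top this
  have hl_mem := hspan (D \ {l}) l hcard (by rwa [Set.insert_sdiff_self_of_mem hl])
  rw [h2] at hI
  have hl_notMem := hI.notMem_span_of_insert (by simp)
  rw [h1]
  refine ((hI.mono (Set.subset_insert _ _)).notMem_span_iff.1 fun hmem => hl_notMem ?_).1
  rwa [h1, Set.image_insert_eq, Submodule.span_insert_eq_span hmem] at hl_mem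

lemma not_linearIndepOn_exchange
    (hspan : ∀ (A : Set V) (b : V), A.encard = k → ¬ Spreadable G (insert b A) →
      homog b ∈ Submodule.span ℚ (homog '' A))
    {A : Set V} {a b c : V} (hA : A.encard + 1 = k) (ha : a ∉ A) (hb : b ∉ A) (hc : c ∉ A)
    (hbc : b ≠ c) (h1 : ¬ Spreadable G (insert b (insert a A)))
    (h2 : ¬ Spreadable G (insert c (insert a A))) :
    ¬ LinearIndepOn ℚ homog (insert c (insert b A)) := by
  intro hI
  have hb_notMem := (hI.mono (Set.subset_insert _ _)).notMem_span_of_insert hb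
  have hc_notMem := hI.notMem_span_of_insert (by simp [hc, Ne.symm hbc])
  have hb_mem := hspan (insert a A) b (by rw [Set.encard_insert_of_notMem ha, hA]) h1
  have hab := hspan (insert b A) a (by rw [Set.encard_insert_of_notMem hb, hA])
    (by rwa [Set.insert_comm])
  have hac := hspan (insert c A) a (by rw [Set.encard_insert_of_notMem hc, hA])
    (by rwa [Set.insert_comm])
  rw [Set.image_insert_eq] at hb_mem hab hac hc_notMem
  by_cases hmem : homog a ∈ Submodule.span ℚ (homog '' A)
  · rw [Submodule.span_insert_eq_span hmem] at hb_mem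
    exact hb_notMem hb_mem
  · refine hc_notMem (Submodule.span_le.2 ?_ (mem_span_insert_exchange hac hmem))
    rintro _ (rfl | hz)
    · exact hab
    · exact Submodule.subset_span (Set.mem_insert_of_mem _ hz)

lemma not_spreadable_exchange
    (hspan : ∀ (A : Set V) (b : V), A.encard = k → ¬ Spreadable G (insert b A) →
      homog b ∈ Submodule.span ℚ (homog '' A))
    {A : Set V} {a b c : V} (hA : A.encard + 1 = k) (ha : a ∉ A) (hb : b ∉ A) (hc : c ∉ A)
    (hbc : b ≠ c) (h1 : ¬ Spreadable G (insert b (insert a A)))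
    (h2 : ¬ Spreadable G (insert c (insert a A))) :
    ¬ Spreadable G (insert c (insert b A)) := by
  rintro ⟨g, hg, hI⟩
  have hbA := not_spreadable_image hg h1
  have hcA := not_spreadable_image hg h2
  simp only [Set.image_insert_eq] at hI hbA hcA
  exact not_linearIndepOn_exchange hspan (by rwa [g.injective.encard_image])
    (by simpa using ha) (by simpa using hb) (by simpa using hc) (g.injective.ne hbc) hbA hcA hI

/-- The affine functional exchanging two points of a minimal non-spreadable set vanishes at the
remaining point. -/
lemma functional_eq_zero (hG : ContainsAffine G)
    (hspread : ∀ A : Set V, A.encard = k → Spreadable G A)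
    (hspan : ∀ (A : Set V) (b : V), A.encard = k → ¬ Spreadable G (insert b A) →
      homog b ∈ Submodule.span ℚ (homog '' A))
    {E : Set V} {i j l m : V} (hE : E.encard + 3 = k) (hi : i ∉ E) (hj : j ∉ E) (hl : l ∉ E)
    (hm : m ∉ E) (hij : i ≠ j) (hil : i ≠ l) (him : i ≠ m) (hjl : j ≠ l) (hjm : j ≠ m)
    (hlm : l ≠ m) (hM : ¬ Spreadable G (insert l (insert m (insert i (insert j E)))))
    (hIl : LinearIndepOn ℚ homog (insert l (insert i (insert j E))))
    {f : V × ℚ →ₗ[ℚ] ℚ} (hfi : f (homog i) = 1) (hfj : f (homog j) = -1)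
    (hf : ∀ x ∈ insert m (insert i (insert j E)), x ≠ i → x ≠ j → f (homog x) = 0) :
    f (homog l) = 0 := by
  classical
  by_contra ht
  set t := f (homog l) with ht_def
  have card3 : ∀ {x y z : V}, x ∉ E → y ∉ E → z ∉ E → x ≠ y → x ≠ z → y ≠ z →
      (insert x (insert y (insert z E))).encard = k := by
    intro x y z hx hy hz hxy hxz hyz
    rw [Set.encard_insert_of_notMem (by simp [*]), Set.encard_insert_of_notMem (by simp [*]),
      Set.encard_insert_of_notMem hz, ← hE, add_assoc, add_assoc]
    norm_num
  have card2 : ∀ {y z : V}, y ∉ E → z ∉ E → y ≠ z →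
      (insert y (insert z E)).encard + 1 = k := by
    intro y z hy hz hyz
    rw [Set.encard_insert_of_notMem (by simp [*]),
      Set.encard_insert_of_notMem hz, ← hE, add_assoc, add_assoc]
    norm_num
  have notMem_of : ∀ {A : Set V} {x : V}, A.encard = k → ¬ Spreadable G (insert x A) →
      x ∉ A := by
    intro A x hA hx hxA
    rw [Set.insert_eq_of_mem hxA] at hx
    exact hx (hspread A hA)
  obtain ⟨σ, hσ, himg, hσx⟩ := hG.exists_swap (s := insert m (insert i (insert j E)))
    (by simp) (by simp) hfi hfj hf
  have hMb := not_spreadable_image hσ hM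
  rw [Set.image_insert_eq, himg, hσx, ← ht_def] at hMb
  set b := l + t • (j - i) with hb
  have hbA := notMem_of (card3 hm hi hj (Ne.symm him) (Ne.symm hjm) hij) hMb
  simp only [Set.mem_insert_iff, not_or] at hbA
  have hlb : l ≠ b := by simp [hb, ht, sub_eq_zero, Ne.symm hij]
  have hMb3 : ¬ Spreadable G (insert b (insert l (insert i (insert j E)))) :=
    not_spreadable_exchange hspan (card2 hi hj hij) (by simp [*, Ne.symm him, Ne.symm hjm])
      (by simp [*, Ne.symm hil, Ne.symm hjl]) (by simp [hbA]) hlb hM hMb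
  obtain ⟨f₂, hf₂⟩ := hIl.exists_functional fun x => if x = i then 1 else if x = j then -1 else 0
  have hf₂i : f₂ (homog i) = 1 := by simpa using hf₂ i (by simp)
  have hf₂j : f₂ (homog j) = -1 := by simpa [Ne.symm hij] using hf₂ j (by simp)
  have hf₂l : f₂ (homog l) = 0 := by simpa [Ne.symm hil, Ne.symm hjl] using hf₂ l (by simp)
  obtain ⟨τ, hτ, himg₂, hτx⟩ := hG.exists_swap (s := insert l (insert i (insert j E)))
    (by simp) (by simp) hf₂i hf₂j fun x hx h1 h2 => by simpa [h1, h2] using hf₂ x hx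
  have hMc3 := not_spreadable_image hτ hMb3
  rw [Set.image_insert_eq, himg₂, hτx] at hMc3
  have hf₂b : f₂ (homog b) = -2 * t := by
    rw [hb, homog_add_smul_sub, map_add, map_smul, map_sub, hf₂i, hf₂j, hf₂l, smul_eq_mul]
    ring
  have hc : b + f₂ (homog b) • (j - i) = l + (-t) • (j - i) := by
    rw [hf₂b, hb]
    module
  rw [hc] at hMc3
  set c := l + (-t) • (j - i) with hc_def
  have hbc : b ≠ c := by
    rw [← hc]
    simp [hf₂b, ht, sub_eq_zero, Ne.symm hij]
  have hcardl := card3 hl hi hj (Ne.symm hil) (Ne.symm hjl) hij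
  have hbA3 := notMem_of hcardl hMb3
  have hcA3 := notMem_of hcardl hMc3
  simp only [Set.mem_insert_iff, not_or] at hbA3 hcA3
  rw [Set.insert_comm l i] at hMb3 hMc3
  have hM4 : ¬ Spreadable G (insert c (insert b (insert l (insert j E)))) :=
    not_spreadable_exchange hspan (card2 hl hj (Ne.symm hjl)) (by simp [*])
      (by simp [hbA3]) (by simp [hcA3]) hbc hMb3 hMc3
  have hset : insert c (insert b (insert l (insert j E))) =
      insert j (insert c (insert b (insert l E))) := by
    rw [Set.insert_comm l j, Set.insert_comm b j, Set.insert_comm c j]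
  rw [hset] at hM4
  have hj_mem := hspan _ _ (card3 hcA3.2.2.2 hbA3.2.2.2 hl (Ne.symm hbc) hcA3.1 hbA3.1) hM4
  obtain ⟨f₃, hf₃⟩ := hIl.exists_functional fun x => if x = i then 1 else if x = j then 1 else 0
  have hf₃i : f₃ (homog i) = 1 := by simpa using hf₃ i (by simp)
  have hf₃j : f₃ (homog j) = 1 := by simpa using hf₃ j (by simp)
  have hf₃l : f₃ (homog l) = 0 := by simpa [Ne.symm hil, Ne.symm hjl] using hf₃ l (by simp)
  have hle : Submodule.span ℚ (homog '' insert c (insert b (insert l E))) ≤ f₃.ker := by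
    rw [Submodule.span_le]
    rintro _ ⟨x, hx, rfl⟩
    rw [SetLike.mem_coe, LinearMap.mem_ker]
    rcases hx with rfl | rfl | rfl | hx
    · rw [hc_def, homog_add_smul_sub]
      simp [hf₃i, hf₃j, hf₃l]
    · rw [hb, homog_add_smul_sub]
      simp [hf₃i, hf₃j, hf₃l]
    · exact hf₃l
    · have h1 : x ≠ i := fun h => hi (h ▸ hx)
      have h2 : x ≠ j := fun h => hj (h ▸ hx)
      simpa [h1, h2] using hf₃ x (by simp [hx])
  have := hle hj_mem
  rw [LinearMap.mem_ker, hf₃j] at this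
  exact one_ne_zero this

lemma spreadable_of_encard_eq_succ (hG : ContainsAffine G) (hk : 3 ≤ k)
    (hspread : ∀ A : Set V, A.encard = k → Spreadable G A)
    (hspan : ∀ (A : Set V) (b : V), A.encard = k → ¬ Spreadable G (insert b A) →
      homog b ∈ Submodule.span ℚ (homog '' A))
    {D : Set V} (hD : D.encard = k + 1) : Spreadable G D := by
  classical
  by_contra hM
  wlog hind : ∃ a ∈ D, LinearIndepOn ℚ homog (D \ {a}) generalizing D
  · obtain ⟨a, ha⟩ : D.Nonempty := by
      rw [← Set.encard_ne_zero, hD]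
      simp
    have hcard := Set.encard_sdiff_singleton_add_one ha
    rw [hD] at hcard
    obtain ⟨g, hg, hI⟩ := hspread _
      (ENat.add_left_injective_of_ne_top ENat.one_ne_top hcard)
    refine this (by rwa [g.injective.encard_image]) (not_spreadable_image hg hM)
      ⟨g a, ⟨a, ha, rfl⟩, ?_⟩
    rwa [Set.image_sdiff g.injective, Set.image_singleton] at hI
  obtain ⟨a, ha, hIa⟩ := hind
  have hI : ∀ l ∈ D, LinearIndepOn ℚ homog (D \ {l}) := fun l hl =>
    linearIndepOn_diff_singleton hspan hD hM ha hl hIa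
  have hfin : D.Finite := Set.finite_of_encard_eq_coe (k := k + 1) (by simpa using hD)
  have hdep : ¬ LinearIndepOn ℚ homog (hfin.toFinset : Set V) := by
    rw [hfin.coe_toFinset]
    exact fun h => hM (spreadable_of_linearIndepOn h)
  obtain ⟨μ, hμ, p, hp, hμp⟩ := not_linearIndepOn_finset_iff.1 hdep
  have hconst : ∀ i ∈ D, ∀ j ∈ D, i ≠ j → μ i = μ j := by
    intro i hi j hj hij
    have hD4 : (3 : ℕ∞) < D.encard := by
      rw [hD]
      exact_mod_cast Nat.lt_succ_of_le hk
    obtain ⟨l, hl, hlS⟩ := exists_mem_notMem_of_encard_lt (s := {i, j}) (t := D) <| by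
      rw [Set.encard_pair hij]
      exact lt_trans (by norm_num) hD4
    obtain ⟨m, hm, hmS⟩ := exists_mem_notMem_of_encard_lt (s := {l, i, j}) (t := D) <| by
      rw [Set.encard_insert_of_notMem hlS, Set.encard_pair hij]
      exact lt_of_le_of_lt (by norm_num) hD4
    simp only [Set.mem_insert_iff, Set.mem_singleton_iff, not_or] at hlS hmS
    obtain ⟨hli, hlj⟩ := hlS
    obtain ⟨hml, hmi, hmj⟩ := hmS
    obtain ⟨f, hf⟩ := (hI l hl).exists_functional
      fun x => if x = i then 1 else if x = j then -1 else 0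
    obtain ⟨hDE, hDl, hDm⟩ := eq_insert_four hl hm hi hj hml hli hlj hmi hmj
    have hE : (D \ {l, m, i, j}).encard + 3 = k := by
      have h1 := hD
      rw [hDE, Set.encard_insert_of_notMem (by simp [Ne.symm hml, hli, hlj]),
        Set.encard_insert_of_notMem (by simp [hmi, hmj]),
        Set.encard_insert_of_notMem (by simp [hij]),
        Set.encard_insert_of_notMem (by simp)] at h1
      have h2 := ENat.add_left_injective_of_ne_top ENat.one_ne_top h1
      rw [← h2, add_assoc, add_assoc]
      norm_num
    have hfi : f (homog i) = 1 := by simpa using hf i ⟨hi, Ne.symm hli⟩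
    have hfj : f (homog j) = -1 := by simpa [Ne.symm hij] using hf j ⟨hj, Ne.symm hlj⟩
    have hfl : f (homog l) = 0 := by
      refine functional_eq_zero hG hspread hspan (E := D \ {l, m, i, j}) (i := i) (j := j)
        (m := m) hE (by simp) (by simp) (by simp) (by simp) hij (Ne.symm hli) (Ne.symm hmi)
        (Ne.symm hlj) (Ne.symm hmj) (Ne.symm hml) (hDE ▸ hM) (hDm ▸ hI m hm) hfi hfj ?_
      rw [← hDl]
      exact fun x hx h1 h2 => by simpa [h1, h2] using hf x hx
    have hfD : ∀ x ∈ hfin.toFinset,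
        μ x * f (homog x) = (if x = i then μ i else 0) - (if x = j then μ j else 0) := by
      intro x hx
      rw [hfin.mem_toFinset] at hx
      by_cases h1 : x = i
      · subst h1
        simp [hfi, hij]
      by_cases h2 : x = j
      · subst h2
        simp [hfj, Ne.symm hij]
      by_cases h3 : x = l
      · subst h3
        simp [hfl, h1, h2]
      · have := hf x ⟨hx, h3⟩
        simp only [h1, h2, if_false] at this
        simp [this, h1, h2]
    have hsum := congrArg f hμ
    simp only [map_sum, map_smul, smul_eq_mul, map_zero] at hsum
    rw [Finset.sum_congr rfl hfD, Finset.sum_sub_distrib, Finset.sum_ite_eq', Finset.sum_ite_eq',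
      if_pos (by simpa using hi), if_pos (by simpa using hj)] at hsum
    exact sub_eq_zero.1 hsum
  have hsum : ∑ x ∈ hfin.toFinset, μ x = 0 := by
    simpa [homog, Prod.snd_sum] using congrArg Prod.snd hμ
  have hall : ∀ x ∈ hfin.toFinset, μ x = μ p := by
    intro x hx
    by_cases hxp : x = p
    · rw [hxp]
    · exact hconst x (by simpa using hx) p (by simpa using hp) hxp
  rw [Finset.sum_congr rfl hall, Finset.sum_const, nsmul_eq_mul] at hsum
  have hcard : hfin.toFinset.card ≠ 0 := Finset.card_ne_zero_of_mem hp
  exact (mul_ne_zero (by exact_mod_cast hcard) hμp) hsum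

/-- Either every finite set is spreadable or `G` contains a nontrivial element fixing everything
outside the span of a finite set. -/
lemma spreadable_or_exists_small_support (hG : ContainsAffine G)
    (hinf : ∀ s : Set V, s.Finite → ∃ x y, x ≠ y ∧ homog x ∉ Submodule.span ℚ (homog '' s) ∧
      homog y ∉ Submodule.span ℚ (homog '' s))
    (hdim : ∀ x : V, ∃ z, z ∉ Submodule.span ℚ {x})
    (hproper : ∃ g ∈ G, ¬ ∃ T : V ≃ₗ[ℚ] V, ∃ b : V, ∀ x, g x = T x + b) :
    (∀ s : Set V, s.Finite → Spreadable G s) ∨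
      ∃ A : Set V, A.Finite ∧ ∃ g ∈ G, (∃ x, g x ≠ x) ∧
        ∀ x, homog x ∉ Submodule.span ℚ (homog '' A) → g x = x := by
  by_contra! h
  obtain ⟨⟨s, hs, hsM⟩, hno⟩ := h
  refine hsM ?_
  clear hsM
  suffices ∀ (k : ℕ) (s : Set V), s.encard = k → Spreadable G s from
    this _ s hs.encard_eq_coe
  intro k
  induction k with
  | zero =>
    intro s hs
    rw [Nat.cast_zero, Set.encard_eq_zero] at hs
    exact spreadable_of_linearIndepOn (hs ▸ linearIndepOn_empty ℚ homog)
  | succ k ih =>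
    intro s hs
    obtain rfl | rfl | rfl | hk : k = 0 ∨ k = 1 ∨ k = 2 ∨ 3 ≤ k := by omega
    · obtain ⟨x, rfl⟩ := Set.encard_eq_one.1 (by simpa using hs)
      exact spreadable_of_linearIndepOn
        ((linearIndepOn_singleton_iff ℚ).2 fun h => one_ne_zero (congrArg Prod.snd h))
    · obtain ⟨x, y, hxy, rfl⟩ := Set.encard_eq_two.1 (by simpa using hs)
      exact spreadable_of_linearIndepOn (linearIndepOn_homog_pair hxy)
    · by_contra hM
      obtain ⟨g, hg, hna⟩ := hproper
      exact hna (exists_affine_of_not_spreadable_triple hG hdim (by simpa using hs) hM hg)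
    · refine spreadable_of_encard_eq_succ hG hk ih (fun A b hA hb => ?_) (by simpa using hs)
      by_contra hcon
      have hfin := Set.finite_of_encard_eq_coe hA
      obtain ⟨g, hg, ⟨x, hx⟩, hfix⟩ := exists_small_support hG hfin (ih A hA) hcon hb hinf
      obtain ⟨y, hy, hgy⟩ := hno A hfin g hg ⟨x, hx⟩
      exact hgy (hfix y hy)

end High

section SmallSupport

variable {V : Type*} [AddCommGroup V] [Module ℚ V] {G : Subgroup (Equiv.Perm V)}

lemma mem_of_homog_mem_span {s : Set V} {W : Submodule ℚ V} (hs : s ⊆ W) {x : V}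
    (hx : homog x ∈ Submodule.span ℚ (homog '' s)) : x ∈ W := by
  have hle : Submodule.span ℚ (homog '' s) ≤ W.comap (LinearMap.fst ℚ V ℚ) := by
    rw [Submodule.span_le]
    rintro _ ⟨y, hy, rfl⟩
    exact hs hy
  exact hle hx

lemma linearIndepOn_homog_image_affine {s : Set V} (hs : LinearIndepOn ℚ homog s)
    (T : V ≃ₗ[ℚ] V) (b : V) : LinearIndepOn ℚ homog ((fun x => T x + b) '' s) := by
  have h := (linearIndependent_homog_affine hs.linearIndependent T b)
  exact LinearIndepOn.image_of_comp (f := fun x => T x + b) (g := homog) (s := s) h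

/-- If every finite set lies in a subspace which some linear automorphism moves to a
complementary position, then a nontrivial element of `G` fixing everything outside the span of a
finite set spreads all finite sets. -/
lemma spreadable_of_small_support (hG : ContainsAffine G)
    (hV : ∀ s : Set V, s.Finite → ∃ W : Submodule ℚ V, s ⊆ W ∧
      ∃ T : V ≃ₗ[ℚ] V, ∀ v ∈ W, T v ∈ W → v = 0)
    {A : Set V} (hA : A.Finite) {g₀ : Equiv.Perm V} (hg₀ : g₀ ∈ G) {x₀ : V} (hx₀ : g₀ x₀ ≠ x₀)
    (hfix : ∀ x, homog x ∉ Submodule.span ℚ (homog '' A) → g₀ x = x)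
    {s : Set V} (hs : s.Finite) : Spreadable G s := by
  induction s, hs using Set.Finite.induction_on with
  | empty => exact spreadable_of_linearIndepOn (linearIndepOn_empty ℚ homog)
  | @insert d s hd hs ih =>
    obtain ⟨g, hg, hi⟩ := ih
    obtain ⟨W, hW, T, hT⟩ := hV (A ∪ insert (g d) (g '' s)) (hA.union ((hs.image g).insert _))
    have hmoved : ∀ x, g₀ x ≠ x → x ∈ W := fun x hx =>
      mem_of_homog_mem_span (Set.subset_union_left.trans hW) (not_imp_comm.1 (hfix x) hx)
    have hsW : g '' s ⊆ W := fun x hx => hW (Or.inr (Or.inr hx))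
    have hdW : g d ∈ W := hW (Or.inr (Or.inl rfl))
    have hxW := hmoved x₀ hx₀
    have hyW := hmoved (g₀ x₀) fun h => hx₀ (g₀.injective h)
    set b := x₀ - T (g d) with hb
    have hfixs : ∀ a ∈ g '' s, g₀ (T a + b) = T a + b := by
      intro a ha
      by_contra hcon
      have h1 : T (a - g d) ∈ W := by
        have := W.sub_mem (hmoved _ hcon) hxW
        rwa [show T a + b - x₀ = T (a - g d) by rw [hb, map_sub]; abel] at this
      have h2 := sub_eq_zero.1 (hT _ (W.sub_mem (hsW ha) hdW) h1)
      rw [h2] at ha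
      exact hd (g.injective.mem_set_image.1 ha)
    let τ : Equiv.Perm V := T.toEquiv.trans (Equiv.addRight b)
    have hτ : ∀ x, τ x = T x + b := fun x => rfl
    refine ⟨g₀ * τ * g, G.mul_mem (G.mul_mem hg₀ (hG τ ⟨T, b, hτ⟩)) hg, ?_⟩
    have hd' : (g₀ * τ * g) d = g₀ x₀ := by simp [hτ, hb]
    have hs' : (g₀ * τ * g) '' s = (fun x => T x + b) '' (g '' s) := by
      rw [Set.image_image]
      refine Set.image_congr fun x hx => ?_
      simpa [hτ] using hfixs _ ⟨x, hx, rfl⟩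
    rw [Set.image_insert_eq, hd', hs']
    refine ((linearIndepOn_homog_image_affine hi T b).notMem_span_iff.1 fun hmem => hx₀ ?_).1
    have hle : Submodule.span ℚ (homog '' ((fun x => T x + b) '' (g '' s))) ≤
        (W.map T.toLinearMap).comap
          (LinearMap.fst ℚ V ℚ - (LinearMap.snd ℚ V ℚ).smulRight x₀) := by
      rw [Submodule.span_le]
      rintro _ ⟨_, ⟨a, ha, rfl⟩, rfl⟩
      refine ⟨a - g d, W.sub_mem (hsW ha) hdW, ?_⟩
      simp only [LinearEquiv.coe_coe, map_sub, homog, hb, LinearMap.sub_apply,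
        LinearMap.fst_apply, LinearMap.smulRight_apply, LinearMap.snd_apply, one_smul]
      abel
    obtain ⟨w, hw, hTw⟩ := hle hmem
    have hTw' : T w = g₀ x₀ - x₀ := by simpa [homog] using hTw
    have h0 := hT w hw (hTw' ▸ W.sub_mem hyW hxW)
    rw [h0, map_zero] at hTw'
    exact sub_eq_zero.1 hTw'.symm

lemma spreadable_of_finite [Nontrivial V] (hG : ContainsAffine G)
    (hV : ∀ s : Set V, s.Finite → ∃ W : Submodule ℚ V, s ⊆ W ∧
      ∃ T : V ≃ₗ[ℚ] V, ∀ v ∈ W, T v ∈ W → v = 0)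
    (hproper : ∃ g ∈ G, ¬ ∃ T : V ≃ₗ[ℚ] V, ∃ b : V, ∀ x, g x = T x + b)
    {s : Set V} (hs : s.Finite) : Spreadable G s := by
  obtain ⟨a, ha⟩ := exists_ne (0 : V)
  have hinf : ∀ s : Set V, s.Finite → ∃ x y, x ≠ y ∧
      homog x ∉ Submodule.span ℚ (homog '' s) ∧ homog y ∉ Submodule.span ℚ (homog '' s) := by
    intro s hs
    obtain ⟨W, hW, T, hT⟩ := hV _ (hs.insert a)
    have haW : a ∈ W := hW (Set.mem_insert _ _)
    have hsW : s ⊆ W := (Set.subset_insert _ _).trans hW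
    refine ⟨T a, T ((2 : ℚ) • a), fun h => ?_, fun h => ?_, fun h => ?_⟩
    · exact ha (left_eq_add.1 ((T.injective h).trans (two_smul ℚ a)))
    · exact ha (hT _ haW (mem_of_homog_mem_span hsW h))
    · simpa [ha] using hT _ (W.smul_mem 2 haW) (mem_of_homog_mem_span hsW h)
  have hdim : ∀ x : V, ∃ z, z ∉ Submodule.span ℚ {x} := by
    intro x
    obtain ⟨W, hW, T, hT⟩ := hV {a, x} (by simp)
    have hle : Submodule.span ℚ {x} ≤ W :=
      (Submodule.span_singleton_le_iff_mem _ _).2 (hW (by simp))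
    exact ⟨T a, fun h => ha (hT a (hW (by simp)) (hle h))⟩
  obtain h | ⟨A, hA, g, hg, ⟨x, hx⟩, hfix⟩ :=
    spreadable_or_exists_small_support hG hinf hdim hproper
  · exact h s hs
  · exact spreadable_of_small_support hG hV hA hg hx hfix hs

lemma exists_map_eq_of_spreadable (hG : ContainsAffine G)
    (hspread : ∀ s : Set V, s.Finite → Spreadable G s) {k : ℕ} {f g : Fin k → V}
    (hf : Function.Injective f) (hg : Function.Injective g) :
    ∃ σ ∈ G, ∀ i, σ (f i) = g i := by
  have key : ∀ p : Fin k → V, Function.Injective p →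
      ∃ σ ∈ G, LinearIndependent ℚ fun i => homog (σ (p i)) := by
    intro p hp
    obtain ⟨σ, hσ, h⟩ := hspread _ (Set.finite_range p)
    rw [← Set.range_comp] at h
    exact ⟨σ, hσ, (linearIndepOn_range_iff (σ.injective.comp hp) homog).1 h⟩
  obtain ⟨σ, hσ, hσf⟩ := key f hf
  obtain ⟨τ, hτ, hτg⟩ := key g hg
  obtain ⟨T, b, hTb⟩ := exists_affine_map_eq k _ _ hσf hτg
  refine ⟨τ⁻¹ * T.toEquiv.trans (Equiv.addRight b) * σ, G.mul_mem (G.mul_mem (G.inv_mem hτ)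
    (hG _ ⟨T, b, fun x => rfl⟩)) hσ, fun i => ?_⟩
  rw [Equiv.Perm.mul_apply, Equiv.Perm.mul_apply, Equiv.Perm.inv_eq_iff_eq]
  exact hTb i

end SmallSupport

section Finsupp

/-- The involution of `ℕ` exchanging `[0, N)` with `[N, 2 * N)`. -/
def swapBlocks (N : ℕ) : Equiv.Perm ℕ :=
  Function.Involutive.toPerm
    (fun i => if i < N then i + N else if i < 2 * N then i - N else i) fun i => by grind

lemma exists_subspace_disjoint_map (s : Set (ℕ →₀ ℚ)) (hs : s.Finite) :
    ∃ W : Submodule ℚ (ℕ →₀ ℚ), s ⊆ W ∧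
      ∃ T : (ℕ →₀ ℚ) ≃ₗ[ℚ] (ℕ →₀ ℚ), ∀ v ∈ W, T v ∈ W → v = 0 := by
  obtain ⟨N, hN⟩ := (hs.toFinset.biUnion Finsupp.support).exists_nat_subset_range
  refine ⟨Finsupp.supported ℚ ℚ (Set.Iio N), fun v hv => ?_,
    Finsupp.domLCongr (swapBlocks N), fun v hv hTv => ?_⟩
  · refine (Finsupp.mem_supported ℚ v).2 fun i hi => ?_
    exact Finset.mem_range.1 (hN (Finset.mem_biUnion.2 ⟨v, by simpa using hv, hi⟩))
  · rw [Finsupp.mem_supported'] at hv hTv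
    ext i
    by_cases hi : i < N
    · have h := hTv (i + N) (by simp)
      have hsymm : (swapBlocks N).symm (i + N) = i := by
        rw [Equiv.symm_apply_eq]
        exact (if_pos hi).symm
      simpa [Finsupp.domLCongr_apply, Finsupp.domCongr_apply, Finsupp.equivMapDomain_apply,
        hsymm] using h
    · exact hv i (by simpa using hi)

end Finsupp

/-- Any group of permutations of `ℚ^{<ω}` properly containing `AGL(ℚ^{<ω})`
is highly transitive. -/
theorem agl_omega_maximal_highly_transitive
    (G : Subgroup (Equiv.Perm (ℕ →₀ ℚ)))
    (hsub : ∀ σ : Equiv.Perm (ℕ →₀ ℚ), IsAGLomega σ → σ ∈ G)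
    (hproper : ∃ σ ∈ G, ¬ IsAGLomega σ) :
    ∀ k : ℕ, 1 ≤ k → ∀ f g : Fin k → (ℕ →₀ ℚ),
      Function.Injective f → Function.Injective g →
      ∃ σ ∈ G, ∀ i, σ (f i) = g i := by
  intro k _ f g hf hg
  have hG : ContainsAffine G := hsub
  exact exists_map_eq_of_spreadable hG
    (fun s hs => spreadable_of_finite hG exists_subspace_disjoint_map hproper hs) hf hg
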